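/- Assume (H2): b₂⁺/e + δ₂₁⁺ < δ₂₂⁻. Then there exists R₁ > 0 such that for every R > R₁ and every x₁ with 0 < x₁ ≤ R, one has g₂(x₁, R) ≥ g₂(R, R) > 0. -/

import Mathlib

open Real Set

/-- `x⁺ := max_{t ∈ [0,ω]} x t`. -/
noncomputable def supC (ω : ℝ) (x : ℝ → ℝ) : ℝ := sSup (x '' Icc 0 ω)

/-- `x⁻ := min_{t ∈ [0,ω]} x t`. -/
noncomputable def infC (ω : ℝ) (x : ℝ → ℝ) : ℝ := sInf (x '' Icc 0 ω)

/-- A continuous, ω-periodic, positive coefficient function. -/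
def NiceCoef (ω : ℝ) (g : ℝ → ℝ) : Prop :=
  Continuous g ∧ Function.Periodic g ω ∧ ∀ t, 0 < g t

/-- The averaged first component
`g₁(x₁,x₂) = (1/ω) ∫₀^ω (δ₁₁ x₁/(c₁₁+x₁) − b₁ x₁ e^{−x₁} − δ₁₂ x₂/(c₁₂+x₂)) dt`. -/
noncomputable def gOne (ω : ℝ) (δ₁₁ δ₁₂ c₁₁ c₁₂ b₁ : ℝ → ℝ) (x₁ x₂ : ℝ) : ℝ :=
  (1 / ω) * ∫ t in (0:ℝ)..ω,
    (δ₁₁ t * x₁ / (c₁₁ t + x₁) - b₁ t * (x₁ * Real.exp (-x₁))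
      - δ₁₂ t * x₂ / (c₁₂ t + x₂))

/-- The averaged second component
`g₂(x₁,x₂) = (1/ω) ∫₀^ω (δ₂₂ x₂/(c₂₂+x₂) − b₂ x₂ e^{−x₂} − δ₂₁ x₁/(c₂₁+x₁)) dt`. -/
noncomputable def gTwo (ω : ℝ) (δ₂₁ δ₂₂ c₂₁ c₂₂ b₂ : ℝ → ℝ) (x₁ x₂ : ℝ) : ℝ :=
  (1 / ω) * ∫ t in (0:ℝ)..ω,
    (δ₂₂ t * x₂ / (c₂₂ t + x₂) - b₂ t * (x₂ * Real.exp (-x₂))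
      - δ₂₁ t * x₁ / (c₂₁ t + x₁))

theorem le_supC_aux {ω : ℝ} {g : ℝ → ℝ} (hg : NiceCoef ω g) {t : ℝ} (ht : t ∈ Icc 0 ω) :
    g t ≤ supC ω g :=
  le_csSup (isCompact_Icc.image hg.1).bddAbove (mem_image_of_mem g ht)

theorem infC_le_aux {ω : ℝ} {g : ℝ → ℝ} (hg : NiceCoef ω g) {t : ℝ} (ht : t ∈ Icc 0 ω) :
    infC ω g ≤ g t :=
  csInf_le (isCompact_Icc.image hg.1).bddBelow (mem_image_of_mem g ht)

theorem cont_aux {ω : ℝ} {d21 d22 c21 c22 b : ℝ → ℝ} (h1 : NiceCoef ω d21)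
    (h2 : NiceCoef ω d22) (h3 : NiceCoef ω c21) (h4 : NiceCoef ω c22) (h5 : NiceCoef ω b)
    {x y : ℝ} (hx : 0 < x) (hy : 0 < y) :
    Continuous fun t => d22 t * y / (c22 t + y) - b t * (y * Real.exp (-y))
      - d21 t * x / (c21 t + x) := by
  refine Continuous.sub (Continuous.sub (Continuous.div (h2.1.mul continuous_const)
    (h4.1.add continuous_const) ?_) (h5.1.mul continuous_const))
    (Continuous.div (h1.1.mul continuous_const) (h3.1.add continuous_const) ?_)
  · intro t
    have := h4.2.2 t
    positivity
  · intro t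
    have := h3.2.2 t
    positivity

/-- Under (H2), g₂ is positive near the upper boundary. -/
theorem gTwo_positive_for_large
    (ω : ℝ) (hω : 0 < ω)
    (δ₁₁ δ₁₂ δ₂₁ δ₂₂ c₁₁ c₁₂ c₂₁ c₂₂ b₁ b₂ : ℝ → ℝ)
    (hδ₁₁ : NiceCoef ω δ₁₁) (hδ₁₂ : NiceCoef ω δ₁₂)
    (hδ₂₁ : NiceCoef ω δ₂₁) (hδ₂₂ : NiceCoef ω δ₂₂)
    (hc₁₁ : NiceCoef ω c₁₁) (hc₁₂ : NiceCoef ω c₁₂)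
    (hc₂₁ : NiceCoef ω c₂₁) (hc₂₂ : NiceCoef ω c₂₂)
    (hb₁ : NiceCoef ω b₁) (hb₂ : NiceCoef ω b₂)
    (H2 : supC ω b₂ / Real.exp 1 + supC ω δ₂₁ < infC ω δ₂₂) :
    ∃ R₁ : ℝ, 0 < R₁ ∧
      ∀ R : ℝ, R₁ < R → ∀ x₁ : ℝ, 0 < x₁ → x₁ ≤ R →
        gTwo ω δ₂₁ δ₂₂ c₂₁ c₂₂ b₂ x₁ R ≥ gTwo ω δ₂₁ δ₂₂ c₂₁ c₂₂ b₂ R R ∧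
        gTwo ω δ₂₁ δ₂₂ c₂₁ c₂₂ b₂ R R > 0 := by
  have h0 : (0:ℝ) ∈ Icc 0 ω := ⟨le_refl _, hω.le⟩
  have hBpos : 0 < supC ω b₂ := (hb₂.2.2 0).trans_le (le_supC_aux hb₂ h0)
  have hSpos : 0 < supC ω δ₂₁ := (hδ₂₁.2.2 0).trans_le (le_supC_aux hδ₂₁ h0)
  have hCpos : 0 < supC ω c₂₂ := (hc₂₂.2.2 0).trans_le (le_supC_aux hc₂₂ h0)
  have hKpos : 0 < supC ω b₂ / Real.exp 1 + supC ω δ₂₁ := by positivity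
  set K := supC ω b₂ / Real.exp 1 + supC ω δ₂₁ with hK
  have hgap : 0 < infC ω δ₂₂ - K := by linarith
  refine ⟨supC ω c₂₂ * K / (infC ω δ₂₂ - K), by positivity, ?_⟩
  intro R hR x hx hxR
  have hRpos : 0 < R := hx.trans_le hxR
  rw [div_lt_iff₀ hgap] at hR
  constructor
  · unfold gTwo
    apply mul_le_mul_of_nonneg_left _ (by positivity)
    apply intervalIntegral.integral_mono_on hω.le
      ((cont_aux hδ₂₁ hδ₂₂ hc₂₁ hc₂₂ hb₂ hRpos hRpos).intervalIntegrable _ _)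
      ((cont_aux hδ₂₁ hδ₂₂ hc₂₁ hc₂₂ hb₂ hx hRpos).intervalIntegrable _ _)
    intro t _
    have hc := hc₂₁.2.2 t
    have hd := hδ₂₁.2.2 t
    have : δ₂₁ t * x / (c₂₁ t + x) ≤ δ₂₁ t * R / (c₂₁ t + R) := by
      rw [div_le_div_iff₀ (by positivity) (by positivity)]
      have := mul_le_mul_of_nonneg_left hxR (mul_pos hd hc).le
      nlinarith
    linarith
  · unfold gTwo
    apply mul_pos (by positivity)
    apply intervalIntegral.intervalIntegral_pos_of_pos_on
      ((cont_aux hδ₂₁ hδ₂₂ hc₂₁ hc₂₂ hb₂ hRpos hRpos).intervalIntegrable _ _) _ hω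
    intro t ht
    have ht' : t ∈ Icc 0 ω := Ioo_subset_Icc_self ht
    have hc := hc₂₁.2.2 t
    have hc2 := hc₂₂.2.2 t
    have hd := hδ₂₁.2.2 t
    have e1 : δ₂₁ t * R / (c₂₁ t + R) ≤ supC ω δ₂₁ := by
      refine le_trans ?_ (le_supC_aux hδ₂₁ ht')
      rw [div_le_iff₀ (by positivity)]
      nlinarith [mul_pos hd hc]
    have e2 : b₂ t * (R * Real.exp (-R)) ≤ supC ω b₂ / Real.exp 1 := by
      rw [div_eq_mul_inv, ← Real.exp_neg]
      apply mul_le_mul (le_supC_aux hb₂ ht') _ (by positivity) hBpos.le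
      have h := Real.add_one_le_exp (R - 1)
      calc R * Real.exp (-R) ≤ Real.exp (R - 1) * Real.exp (-R) := by
            apply mul_le_mul_of_nonneg_right _ (Real.exp_pos _).le
            linarith
        _ = Real.exp (-1) := by
            rw [← Real.exp_add]
            congr 1
            ring
    have e3 : K < δ₂₂ t * R / (c₂₂ t + R) := by
      rw [lt_div_iff₀ (by positivity)]
      have a1 := mul_le_mul_of_nonneg_right (infC_le_aux hδ₂₂ ht') hRpos.le
      have a2 := mul_le_mul_of_nonneg_left (le_supC_aux hc₂₂ ht') hKpos.le
      nlinarith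
    linarith
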